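/- arXiv:1305.2858 — 3 statements merged into one kernel-verified Lean document; each statement's English description precedes it below -/
import Mathlib

section
/- Let V be a real inner product space, X ∈ V a fixed vector, and F(y) = ⟨y,y⟩/⟨X,y⟩ the associated Kropina norm with fundamental tensor g_Y. If Y, U ∈ V are orthonormal (⟨Y,Y⟩ = ⟨U,U⟩ = 1, ⟨Y,U⟩ = 0) and ⟨X,Y⟩ ≠ 0, then g_Y(U,U) = (2⟨X,Y⟩² + 3⟨X,U⟩²)/⟨X,Y⟩⁴. -/
open scoped RealInnerProductSpace

/-- The Kropina norm `F(y) = ⟨y,y⟩ / ⟨X,y⟩` associated with the inner product and the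
fixed vector `X`. -/
noncomputable def kropinaF {V : Type*} [NormedAddCommGroup V] [InnerProductSpace ℝ V]
    (X y : V) : ℝ :=
  ⟪y, y⟫ / ⟪X, y⟫

/-- The fundamental tensor of the Kropina norm:
`g_Y(U,W) = (1/2) ∂²/∂s∂t [F(Y+sU+tW)²]|_{s=t=0}`. -/
noncomputable def kropinaG {V : Type*} [NormedAddCommGroup V] [InnerProductSpace ℝ V]
    (X Y U W : V) : ℝ :=
  (1 / 2) *
    deriv (fun s : ℝ => deriv (fun t : ℝ => (kropinaF X (Y + s • U + t • W)) ^ 2) 0) 0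

/-- For orthonormal `Y, U`: `g_Y(U,U) = (2⟨X,Y⟩² + 3⟨X,U⟩²)/⟨X,Y⟩⁴`. -/
theorem kropinaG_orthonormal_UU {V : Type*} [NormedAddCommGroup V] [InnerProductSpace ℝ V]
    (X Y U : V) (hY : ⟪Y, Y⟫ = 1) (hU : ⟪U, U⟫ = 1) (hYU : ⟪Y, U⟫ = 0)
    (hXY : ⟪X, Y⟫ ≠ 0) :
    kropinaG X Y U U = (2 * ⟪X, Y⟫ ^ 2 + 3 * ⟪X, U⟫ ^ 2) / ⟪X, Y⟫ ^ 4 := by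
  have hUY : ⟪U, Y⟫ = 0 := by rw [real_inner_comm]; exact hYU
  have hF : ∀ s t : ℝ, (kropinaF X (Y + s • U + t • U)) ^ 2
      = ((1 + (s + t) ^ 2) / (⟪X, Y⟫ + (s + t) * ⟪X, U⟫)) ^ 2 := by
    intro s t
    have h1 : Y + s • U + t • U = Y + (s + t) • U := by rw [add_smul, add_assoc]
    rw [h1, kropinaF]
    simp only [inner_add_left, inner_add_right, real_inner_smul_left, real_inner_smul_right,
      hY, hU, hYU, hUY]
    congr 2
    ring
  unfold kropinaG
  simp only [hF]
  generalize ⟪X, Y⟫ = a at *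
  generalize ⟪X, U⟫ = b at *
  have hin : ∀ s : ℝ, a + s * b ≠ 0 →
      deriv (fun t : ℝ => ((1 + (s + t) ^ 2) / (a + (s + t) * b)) ^ 2) 0
      = 2 * (1 + s ^ 2) * (2 * s * (a + s * b) - (1 + s ^ 2) * b) / (a + s * b) ^ 3 := by
    intro s hs
    have hid : HasDerivAt (fun t : ℝ => s + t) 1 0 := (hasDerivAt_id (0 : ℝ)).const_add s
    have hn := (hid.pow 2).const_add 1
    have hd := (hid.mul_const b).const_add a
    have h := ((hn.div hd (by simpa using hs)).pow 2).deriv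
    refine Eq.trans h ?_
    simp
    field_simp
  have hev : (fun s : ℝ => deriv (fun t : ℝ => ((1 + (s + t) ^ 2) / (a + (s + t) * b)) ^ 2) 0)
      =ᶠ[nhds 0] fun s =>
        2 * (1 + s ^ 2) * (2 * s * (a + s * b) - (1 + s ^ 2) * b) / (a + s * b) ^ 3 := by
    have hc : ContinuousAt (fun s : ℝ => a + s * b) 0 := by fun_prop
    have := hc.eventually_ne (y := 0) (by simpa using hXY)
    filter_upwards [this] with s hs using hin s hs
  rw [hev.deriv_eq]
  have hid := hasDerivAt_id (0 : ℝ)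
  have hp := (hid.pow 2).const_add 1
  have hd := (hid.mul_const b).const_add a
  have hnum := (hp.const_mul 2).mul (((hid.const_mul 2).mul hd).sub (hp.mul_const b))
  have h := (hnum.div (hd.pow 3) (by simpa using hXY)).deriv
  have h2 : ∀ x y z : ℝ, x = y → (1 / 2) * y = z → (1 / 2) * x = z := by
    intro x y z h h'; rw [h, h']
  refine h2 _ _ _ h ?_
  simp
  field_simp
end

section
/- Let V be a real inner product space, X ∈ V a fixed vector, and F(y) = ⟨y,y⟩/⟨X,y⟩ the associated Kropina norm with fundamental tensor g_Y. If Y, U ∈ V are orthonormal (⟨Y,Y⟩ = ⟨U,U⟩ = 1, ⟨Y,U⟩ = 0) and ⟨X,Y⟩ ≠ 0, then g_Y(Y,Y)·g_Y(U,U) − g_Y(Y,U)² = 2⟨X,U⟩²/⟨X,Y⟩⁶ + 2/⟨X,Y⟩⁴. -/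
open scoped RealInnerProductSpace

lemma kropinaG_formula {V : Type*} [NormedAddCommGroup V] [InnerProductSpace ℝ V]
    (X Y U W : V) (hXY : ⟪X, Y⟫ ≠ 0) :
    kropinaG X Y U W =
      4 * ⟪Y, U⟫ * ⟪Y, W⟫ / ⟪X, Y⟫ ^ 2 + 2 * ⟪Y, Y⟫ * ⟪U, W⟫ / ⟪X, Y⟫ ^ 2
      - 4 * ⟪Y, Y⟫ * ⟪Y, W⟫ * ⟪X, U⟫ / ⟪X, Y⟫ ^ 3
      - 4 * ⟪Y, Y⟫ * ⟪Y, U⟫ * ⟪X, W⟫ / ⟪X, Y⟫ ^ 3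
      + 3 * ⟪Y, Y⟫ ^ 2 * ⟪X, U⟫ * ⟪X, W⟫ / ⟪X, Y⟫ ^ 4 := by
  have expand : ∀ s t : ℝ, kropinaF X (Y + s • U + t • W) =
      ((⟪Y, Y⟫ + 2 * s * ⟪Y, U⟫ + s ^ 2 * ⟪U, U⟫) + t * (2 * ⟪Y, W⟫ + 2 * s * ⟪U, W⟫)
        + t ^ 2 * ⟪W, W⟫) / ((⟪X, Y⟫ + s * ⟪X, U⟫) + t * ⟪X, W⟫) := by
    intro s t
    unfold kropinaF
    simp only [inner_add_left, inner_add_right, real_inner_smul_left, real_inner_smul_right]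
    rw [real_inner_comm Y U, real_inner_comm Y W, real_inner_comm U W]
    congr 1
    ring
  unfold kropinaG
  simp only [expand]
  generalize ⟪Y, Y⟫ = n, ⟪Y, U⟫ = p, ⟪U, U⟫ = uu, ⟪Y, W⟫ = q, ⟪U, W⟫ = r, ⟪W, W⟫ = ww,
    ⟪X, U⟫ = c, ⟪X, W⟫ = d
  generalize ⟪X, Y⟫ = b at hXY
  have inner_deriv : ∀ N M B : ℝ, B ≠ 0 →
      deriv (fun t : ℝ => ((N + t * M + t ^ 2 * ww) / (B + t * d)) ^ 2) 0
        = 2 * N * M / B ^ 2 - 2 * N ^ 2 * d / B ^ 3 := by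
    intro N M B hB
    have h1 : HasDerivAt (fun t : ℝ => N + t * M + t ^ 2 * ww) M 0 := by
      have := (((hasDerivAt_id (0:ℝ)).mul_const M).const_add N).add
        (((hasDerivAt_id (0:ℝ)).pow 2).mul_const ww)
      exact this.congr_deriv (by simp)
    have h2 : HasDerivAt (fun t : ℝ => B + t * d) d 0 := by
      have := ((hasDerivAt_id (0:ℝ)).mul_const d).const_add B
      exact this.congr_deriv (by simp)
    have h3 := ((h1.fun_div h2 (by simpa using hB)).fun_pow 2).deriv
    rw [h3]
    simp
    field_simp
  have hev : (fun s : ℝ => deriv (fun t : ℝ => (((n + 2 * s * p + s ^ 2 * uu)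
        + t * (2 * q + 2 * s * r) + t ^ 2 * ww) / ((b + s * c) + t * d)) ^ 2) 0)
      =ᶠ[nhds 0] (fun s : ℝ => 2 * (n + 2 * s * p + s ^ 2 * uu) * (2 * q + 2 * s * r)
        / (b + s * c) ^ 2 - 2 * (n + 2 * s * p + s ^ 2 * uu) ^ 2 * d / (b + s * c) ^ 3) := by
    have hc : ContinuousAt (fun s : ℝ => b + s * c) 0 := by fun_prop
    filter_upwards [hc.eventually_ne (by simpa using hXY)] with s hs
    exact inner_deriv _ _ _ hs
  rw [hev.deriv_eq]
  have hN : HasDerivAt (fun s : ℝ => n + 2 * s * p + s ^ 2 * uu) (2 * p) 0 := by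
    have := ((((hasDerivAt_id (0:ℝ)).const_mul 2).mul_const p).const_add n).add
      (((hasDerivAt_id (0:ℝ)).pow 2).mul_const uu)
    exact this.congr_deriv (by simp)
  have hM : HasDerivAt (fun s : ℝ => 2 * q + 2 * s * r) (2 * r) 0 := by
    have := (((hasDerivAt_id (0:ℝ)).const_mul 2).mul_const r).const_add (2 * q)
    exact this.congr_deriv (by simp)
  have hB : HasDerivAt (fun s : ℝ => b + s * c) c 0 := by
    have := ((hasDerivAt_id (0:ℝ)).mul_const c).const_add b
    exact this.congr_deriv (by simp)
  have h := ((((hN.const_mul 2).fun_mul hM).fun_div (hB.fun_pow 2) (by simpa using hXY)).fun_sub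
    ((((hN.fun_pow 2).const_mul 2).mul_const d).fun_div (hB.fun_pow 3) (by simpa using hXY))).deriv
  rw [h]
  simp
  field_simp
  ring

/-- For orthonormal `Y, U`:
`g_Y(Y,Y)·g_Y(U,U) − g_Y(Y,U)² = 2⟨X,U⟩²/⟨X,Y⟩⁶ + 2/⟨X,Y⟩⁴`. -/
theorem kropinaG_flag_denominator {V : Type*} [NormedAddCommGroup V] [InnerProductSpace ℝ V]
    (X Y U : V) (hY : ⟪Y, Y⟫ = 1) (hU : ⟪U, U⟫ = 1) (hYU : ⟪Y, U⟫ = 0)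
    (hXY : ⟪X, Y⟫ ≠ 0) :
    kropinaG X Y Y Y * kropinaG X Y U U - (kropinaG X Y Y U) ^ 2 =
      2 * ⟪X, U⟫ ^ 2 / ⟪X, Y⟫ ^ 6 + 2 / ⟪X, Y⟫ ^ 4 := by
  rw [kropinaG_formula X Y Y Y hXY, kropinaG_formula X Y U U hXY, kropinaG_formula X Y Y U hXY,
    hY, hU, hYU]
  field_simp
  ring
end

section
/- Let V be a real inner product space, X ∈ V a fixed vector, and F(y) = ⟨y,y⟩/⟨X,y⟩ the associated Kropina norm with fundamental tensor g_Y. If Y, U ∈ V are orthonormal (⟨Y,Y⟩ = ⟨U,U⟩ = 1, ⟨Y,U⟩ = 0), ⟨X,Y⟩ ≠ 0, and W ∈ V satisfies ⟨W,Y⟩ = 0, then the flag-curvature quotient satisfies g_Y(W,U)/(g_Y(Y,Y)·g_Y(U,U) − g_Y(Y,U)²) = (3⟨X,U⟩⟨X,W⟩ + 2⟨X,Y⟩²⟨W,U⟩)/(2(⟨X,U⟩/⟨X,Y⟩)² + 2). -/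
open scoped RealInnerProductSpace

/-- One-variable derivative used twice. -/
lemma kropina_inner_deriv (n q m c w : ℝ) (hc : c ≠ 0) :
    deriv (fun t : ℝ => ((n + 2 * t * q + t ^ 2 * m) / (c + t * w)) ^ 2) 0 =
      4 * n * q / c ^ 2 - 2 * n ^ 2 * w / c ^ 3 := by
  have h1 : HasDerivAt (fun t : ℝ => n + 2 * t * q + t ^ 2 * m) (2 * q) 0 := by
    have := ((((hasDerivAt_id (0 : ℝ)).const_mul 2).mul_const q).const_add n).add
      (((hasDerivAt_id (0 : ℝ)).pow 2).mul_const m)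
    refine this.congr_deriv ?_
    simp
  have h2 : HasDerivAt (fun t : ℝ => c + t * w) w 0 := by
    have := ((hasDerivAt_id (0 : ℝ)).mul_const w).const_add c
    refine this.congr_deriv ?_
    simp
  have h3 := (h1.div h2 (by simpa using hc)).pow 2
  refine (h3.congr_deriv ?_).deriv
  simp
  field_simp
  ring

lemma kropina_outer_deriv (n p k q r c u w : ℝ) (hc : c ≠ 0) :
    deriv (fun s : ℝ => 4 * (n + 2 * s * p + s ^ 2 * k) * (q + s * r) / (c + s * u) ^ 2
      - 2 * (n + 2 * s * p + s ^ 2 * k) ^ 2 * w / (c + s * u) ^ 3) 0 =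
      8 * p * q / c ^ 2 + 4 * n * r / c ^ 2 - 8 * n * q * u / c ^ 3
        - 8 * n * p * w / c ^ 3 + 6 * n ^ 2 * u * w / c ^ 4 := by
  have h1 : HasDerivAt (fun t : ℝ => n + 2 * t * p + t ^ 2 * k) (2 * p) 0 := by
    have := ((((hasDerivAt_id (0 : ℝ)).const_mul 2).mul_const p).const_add n).add
      (((hasDerivAt_id (0 : ℝ)).pow 2).mul_const k)
    refine this.congr_deriv ?_
    simp
  have h2 (c w : ℝ) : HasDerivAt (fun t : ℝ => c + t * w) w 0 := by
    have := ((hasDerivAt_id (0 : ℝ)).mul_const w).const_add c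
    refine this.congr_deriv ?_
    simp
  have h3 := (((h1.const_mul 4).mul (h2 q r)).div ((h2 c u).pow 2) (by simpa using hc)).sub
    ((((h1.pow 2).const_mul 2).mul_const w).div ((h2 c u).pow 3) (by simpa using hc))
  refine (h3.congr_deriv ?_).deriv
  simp
  field_simp
  ring

lemma kropinaG_eq {V : Type*} [NormedAddCommGroup V] [InnerProductSpace ℝ V]
    (X Y U W : V) (h : ⟪X, Y⟫ ≠ 0) :
    kropinaG X Y U W = (1 / 2) * (8 * ⟪Y, U⟫ * ⟪Y, W⟫ / ⟪X, Y⟫ ^ 2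
      + 4 * ⟪Y, Y⟫ * ⟪U, W⟫ / ⟪X, Y⟫ ^ 2 - 8 * ⟪Y, Y⟫ * ⟪Y, W⟫ * ⟪X, U⟫ / ⟪X, Y⟫ ^ 3
      - 8 * ⟪Y, Y⟫ * ⟪Y, U⟫ * ⟪X, W⟫ / ⟪X, Y⟫ ^ 3
      + 6 * ⟪Y, Y⟫ ^ 2 * ⟪X, U⟫ * ⟪X, W⟫ / ⟪X, Y⟫ ^ 4) := by
  unfold kropinaG
  congr 1
  rw [← kropina_outer_deriv ⟪Y, Y⟫ ⟪Y, U⟫ ⟪U, U⟫ ⟪Y, W⟫ ⟪U, W⟫ ⟪X, Y⟫ ⟪X, U⟫ ⟪X, W⟫ h]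
  apply Filter.EventuallyEq.deriv_eq
  have hcont : ContinuousAt (fun s : ℝ => ⟪X, Y⟫ + s * ⟪X, U⟫) 0 := by fun_prop
  filter_upwards [hcont.eventually_ne (by simpa using h)] with s hs
  rw [← kropina_inner_deriv _ _ ⟪W, W⟫ _ _ hs]
  congr 1
  funext t
  unfold kropinaF
  congr 2
  · simp only [inner_add_left, inner_add_right, real_inner_smul_left, real_inner_smul_right]
    rw [real_inner_comm Y U, real_inner_comm Y W, real_inner_comm U W]
    ring
  · simp only [inner_add_right, real_inner_smul_right]

/-- For orthonormal `Y, U` and `W` orthogonal to `Y`, the flag-curvature quotient is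
`g_Y(W,U)/(g_Y(Y,Y)·g_Y(U,U) − g_Y(Y,U)²)
  = (3⟨X,U⟩⟨X,W⟩ + 2⟨X,Y⟩²⟨W,U⟩)/(2(⟨X,U⟩/⟨X,Y⟩)² + 2)`. -/
theorem kropina_flag_curvature_quotient {V : Type*} [NormedAddCommGroup V]
    [InnerProductSpace ℝ V] (X Y U W : V) (hY : ⟪Y, Y⟫ = 1) (hU : ⟪U, U⟫ = 1)
    (hYU : ⟪Y, U⟫ = 0) (hXY : ⟪X, Y⟫ ≠ 0) (hWY : ⟪W, Y⟫ = 0) :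
    kropinaG X Y W U / (kropinaG X Y Y Y * kropinaG X Y U U - (kropinaG X Y Y U) ^ 2) =
      (3 * ⟪X, U⟫ * ⟪X, W⟫ + 2 * ⟪X, Y⟫ ^ 2 * ⟪W, U⟫) /
        (2 * (⟪X, U⟫ / ⟪X, Y⟫) ^ 2 + 2) := by
  rw [kropinaG_eq X Y W U hXY, kropinaG_eq X Y Y Y hXY, kropinaG_eq X Y U U hXY,
    kropinaG_eq X Y Y U hXY]
  have hYW : ⟪Y, W⟫ = 0 := by rw [real_inner_comm]; exact hWY
  rw [hY, hU, hYU, hYW]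
  generalize ⟪X, Y⟫ = b at *
  generalize ⟪X, U⟫ = u
  generalize ⟪X, W⟫ = w
  generalize ⟪W, U⟫ = r
  have hb : 0 < b ^ 2 := by positivity
  have hp : u ^ 2 + b ^ 2 ≠ 0 := by positivity
  have hd : 2 * (u / b) ^ 2 + 2 = 2 * (u ^ 2 + b ^ 2) / b ^ 2 := by
    field_simp
  have e : ∀ D N M : ℝ, D = 2 * (u ^ 2 + b ^ 2) / b ^ 6 → N = M / b ^ 4 →
      N / D = M / (2 * (u ^ 2 + b ^ 2) / b ^ 2) := by
    rintro D N M rfl rfl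
    field_simp
  rw [hd]
  apply e
  · field_simp
    ring
  · field_simp
    ring
end
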